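/- Let 0<Δ<1 and let C₂ be the constant from the upper-bound estimate. There exist constants C₃>0 and h₀∈(0,1), depending only on Δ, such that for every h∈(0,h₀): if y ∈ C²(cl(B₁); ℝ³) satisfies I_{h,Δ}(y) ≤ 2πΔ²h²(log(1/h) + C₂), then the membrane energy satisfies ∫_{B₁} |g_y − g_Δ|² dL² ≤ C₃ h². -/

import Mathlib

open MeasureTheory Metric Real Filter Matrix
open scoped ENNReal Topology

noncomputable section

/-- The plane `ℝ²` with the Euclidean norm. -/
abbrev E2 : Type := EuclideanSpace ℝ (Fin 2)
/-- The space `ℝ³` with the Euclidean norm. -/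
abbrev E3 : Type := EuclideanSpace ℝ (Fin 3)

/-- The `i`-th standard basis vector of `ℝ²`. -/
def e2 (i : Fin 2) : E2 := EuclideanSpace.single i 1

/-- Partial derivative in the direction of the `i`-th coordinate. -/
def pd (i : Fin 2) (f : E2 → ℝ) (x : E2) : ℝ := fderiv ℝ f x (e2 i)

/-- Hessian matrix of a scalar function on `ℝ²`. -/
def hess (f : E2 → ℝ) (x : E2) : Matrix (Fin 2) (Fin 2) ℝ :=
  Matrix.of fun i j => pd i (pd j f) x

/-- Derivative matrix `Dy ∈ ℝ^{3×2}` of a map `y : ℝ² → ℝ³`. -/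
def Dmat (y : E2 → E3) (x : E2) : Matrix (Fin 3) (Fin 2) ℝ :=
  Matrix.of fun i j => pd j (fun z => y z i) x

/-- Induced metric `g_y = (Dy)ᵀ Dy`. -/
def gmet (y : E2 → E3) (x : E2) : Matrix (Fin 2) (Fin 2) ℝ :=
  (Dmat y x)ᵀ * Dmat y x

/-- The rotated vector `x⊥ = (-x₂, x₁)`. -/
def perpVec (x : E2) : Fin 2 → ℝ := ![-(x 1), x 0]

/-- The unit tangent `x̂⊥ = (-x₂, x₁)/|x|`. -/
def xperpUnit (x : E2) : Fin 2 → ℝ := fun i => perpVec x i / ‖x‖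

/-- The reference (cone) metric `g_Δ = Id - Δ² x̂⊥ ⊗ x̂⊥`. -/
def gDelta (Δ : ℝ) (x : E2) : Matrix (Fin 2) (Fin 2) ℝ :=
  1 - Matrix.of fun i j => (Δ ^ 2 / ‖x‖ ^ 2) * perpVec x i * perpVec x j

/-- Squared Frobenius norm of a matrix. -/
def frob2 {m n : Type*} [Fintype m] [Fintype n] (A : Matrix m n ℝ) : ℝ :=
  ∑ i, ∑ j, (A i j) ^ 2

/-- `|D²y|²`: the sum of the squared Frobenius norms of the Hessians of the components. -/
def hessNormSq (y : E2 → E3) (x : E2) : ℝ :=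
  ∑ i : Fin 3, frob2 (hess (fun z => y z i) x)

/-- The free elastic energy `I_{h,Δ}(y)`. -/
def energy (h Δ : ℝ) (y : E2 → E3) : ℝ :=
  ∫ x in ball (0 : E2) 1, (frob2 (gmet y x - gDelta Δ x) + h ^ 2 * hessNormSq y x)

/-- The singular cone `y^Δ(x) = √(1-Δ²)·(x,0) + Δ|x| e₃`. -/
def coneMap (Δ : ℝ) (x : E2) : E3 :=
  (WithLp.equiv 2 (Fin 3 → ℝ)).symm
    ![Real.sqrt (1 - Δ ^ 2) * x 0, Real.sqrt (1 - Δ ^ 2) * x 1, Δ * ‖x‖]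


lemma wirt (f f' : ℝ → ℝ) (hf : ∀ x, HasDerivAt f (f' x) x) (hc : Continuous f')
    (hp : f (-π) = f π) (h0 : ∫ x in (-π)..π, f x = 0) :
    ∫ x in (-π)..π, (f x)^2 ≤ ∫ x in (-π)..π, (f' x)^2 := by
  have hab : -π < π := by linarith [pi_pos]
  have hfc : Continuous f := continuous_iff_continuousAt.2 fun x => (hf x).continuousAt
  have key : ∀ g : ℝ → ℝ, Continuous g → MemLp (fun x => (g x : ℂ)) 2 (volume.restrict (Set.Ioc (-π) π)) := by
    intro g hg
    have : Continuous (fun x => (g x : ℂ)) := by fun_prop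
    refine (memLp_two_iff_integrable_sq_norm this.aestronglyMeasurable).2 ?_
    have h2 : Continuous (fun x => ‖(g x : ℂ)‖ ^ 2) := by fun_prop
    exact (h2.continuousOn.integrableOn_compact (isCompact_Icc (a := -π) (b := π))).mono_set Set.Ioc_subset_Icc_self
  have h1 := hasSum_sq_fourierCoeffOn hab (key f hfc)
  have h2 := hasSum_sq_fourierCoeffOn hab (key f' hc)
  have hle := hasSum_le (fun n : ℤ => ?_) h1 h2
  · simp only [Complex.norm_real, Real.norm_eq_abs, sq_abs, smul_eq_mul] at hle
    exact le_of_mul_le_mul_left hle (by apply inv_pos.2; linarith)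
  · rcases eq_or_ne n 0 with rfl | hn
    · rw [fourierCoeffOn_eq_integral]
      have : ∫ x in (-π)..π, (f x : ℂ) = 0 := by
        rw [intervalIntegral.integral_ofReal, h0]; simp
      simp [this]
    · rw [fourierCoeffOn_of_hasDerivAt hab hn (f' := fun x => (f' x : ℂ)) (fun x _ => (hf x).ofReal_comp)
        ((by fun_prop : Continuous fun x => (f' x : ℂ)).intervalIntegrable _ _)]
      rw [hp]
      simp only [sub_self, mul_zero, zero_sub, norm_mul, norm_neg]
      gcongr
      have e : ‖(1:ℂ) / (-2 * π * Complex.I * n)‖ = 1 / (2 * π * |(n:ℝ)|) := by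
        simp [abs_of_pos pi_pos]
      have e2 : ‖((π:ℂ) - ((-π : ℝ):ℂ))‖ = 2 * π := by
        rw [← Complex.ofReal_sub, Complex.norm_real, Real.norm_eq_abs, abs_of_pos] <;> linarith [pi_pos]
      rw [e, e2]
      have hn1 : (1:ℝ) ≤ |(n:ℝ)| := by
        exact_mod_cast Int.one_le_abs hn
      rw [← mul_assoc]
      apply mul_le_of_le_one_left (norm_nonneg _)
      have := pi_pos
      rw [one_div_mul_eq_div, div_le_one (by positivity)]
      nlinarith

lemma area_ineq (v0 v1 d0 d1 : ℝ → ℝ) (h0 : ∀ x, HasDerivAt v0 (d0 x) x)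
    (h1 : ∀ x, HasDerivAt v1 (d1 x) x) (c0 : Continuous d0) (c1 : Continuous d1)
    (p0 : v0 (-π) = v0 π) (p1 : v1 (-π) = v1 π) :
    ∫ x in (-π)..π, (v0 x * d1 x - v1 x * d0 x) ≤ ∫ x in (-π)..π, ((d0 x)^2 + (d1 x)^2) := by
  have k0 : Continuous v0 := continuous_iff_continuousAt.2 fun x => (h0 x).continuousAt
  have k1 : Continuous v1 := continuous_iff_continuousAt.2 fun x => (h1 x).continuousAt
  have hpi := pi_pos
  set c := (∫ x in (-π)..π, v0 x) / (2 * π) with hc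
  have W := wirt (fun x => v0 x - c) d0 (fun x => (h0 x).sub_const c) c0 (by simp [p0]) (by
    rw [intervalIntegral.integral_sub (k0.intervalIntegrable _ _) (by simp)]
    simp [hc]; field_simp; ring)
  have F := intervalIntegral.integral_eq_sub_of_hasDerivAt (a := -π) (b := π)
    (f := fun x => (v0 x - 2 * c) * v1 x) (f' := fun x => d0 x * v1 x + (v0 x - 2 * c) * d1 x)
    (fun x _ => ((h0 x).sub_const _).mul (h1 x))
    ((by fun_prop : Continuous _).intervalIntegrable _ _)
  rw [p0, p1, sub_self] at F
  have A : ∫ x in (-π)..π, (v0 x * d1 x - v1 x * d0 x) =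
      ∫ x in (-π)..π, (2 * (v0 x - c) * d1 x) := by
    rw [← sub_eq_zero, ← neg_eq_zero, ← F, ← intervalIntegral.integral_sub
      ((by fun_prop : Continuous _).intervalIntegrable _ _) ((by fun_prop : Continuous _).intervalIntegrable _ _),
      ← intervalIntegral.integral_neg]
    congr 1; ext x; ring
  rw [A, intervalIntegral.integral_add ((by fun_prop : Continuous _).intervalIntegrable _ _) ((by fun_prop : Continuous _).intervalIntegrable _ _)]
  refine le_trans ?_ (add_le_add_left W _)
  rw [← intervalIntegral.integral_add ((by fun_prop : Continuous _).intervalIntegrable _ _) ((by fun_prop : Continuous _).intervalIntegrable _ _)]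
  apply intervalIntegral.integral_mono (by linarith) ((by fun_prop : Continuous _).intervalIntegrable _ _) ((by fun_prop : Continuous _).intervalIntegrable _ _)
  intro x
  simp only
  nlinarith [sq_nonneg (v0 x - c - d1 x)]

def mu : Measure (ℝ × ℝ) := (volume.restrict (Set.Ioc 0 1)).prod (volume.restrict (Set.Ioc (-π) π))

lemma mu_eq : mu = (volume : Measure (ℝ × ℝ)).restrict (Set.Ioc 0 1 ×ˢ Set.Ioc (-π) π) := by
  rw [mu, Measure.prod_restrict]; rfl

lemma cint {F : ℝ × ℝ → ℝ} (hF : Continuous F) : Integrable F mu := by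
  rw [mu_eq]
  have : IntegrableOn F (Set.Icc 0 1 ×ˢ Set.Icc (-π) π) volume :=
    hF.continuousOn.integrableOn_compact (isCompact_Icc.prod isCompact_Icc)
  exact this.mono_set (Set.prod_mono Set.Ioc_subset_Icc_self Set.Ioc_subset_Icc_self)

lemma mu_rt {F : ℝ × ℝ → ℝ} (hF : Continuous F) :
    ∫ p, F p ∂mu = ∫ r in (0:ℝ)..1, ∫ t in (-π)..π, F (r, t) := by
  have := integral_prod F (cint hF)
  rw [intervalIntegral.integral_of_le zero_le_one]
  simp only [intervalIntegral.integral_of_le (by linarith [pi_pos] : -π ≤ π)]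
  exact this

lemma mu_tr {F : ℝ × ℝ → ℝ} (hF : Continuous F) :
    ∫ p, F p ∂mu = ∫ t in (-π)..π, ∫ r in (0:ℝ)..1, F (r, t) := by
  have := integral_prod_symm F (cint hF)
  simp only [intervalIntegral.integral_of_le zero_le_one]
  simp only [intervalIntegral.integral_of_le (by linarith [pi_pos] : -π ≤ π)]
  exact this

lemma mu_ae {P : ℝ × ℝ → Prop} (h : ∀ r t, 0 < r → r ≤ 1 → P (r, t)) : ∀ᵐ p ∂mu, P p := by
  rw [mu_eq]
  filter_upwards [ae_restrict_mem (measurableSet_Ioc.prod measurableSet_Ioc)] with p hp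
  exact h p.1 p.2 hp.1.1 hp.1.2

abbrev XX (r t : ℝ) : EuclideanSpace ℝ (Fin 2) := !₂[r * cos t, r * sin t]

lemma polar (f : EuclideanSpace ℝ (Fin 2) → ℝ) (F : ℝ × ℝ → ℝ)
    (h : ∀ r t, 0 < r → f (XX r t) = F (r, t)) :
    ∫ x in ball (0 : EuclideanSpace ℝ (Fin 2)) 1, f x = ∫ p, p.1 * F p ∂mu := by
  have mp := (PiLp.volume_preserving_toLp (Fin 2)).comp ((volume_preserving_finTwoArrow ℝ).symm)
  have me : MeasurableEmbedding (fun p : ℝ × ℝ => WithLp.toLp 2 ((MeasurableEquiv.finTwoArrow (α := ℝ)).symm p)) :=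
    (MeasurableEquiv.toLp 2 (Fin 2 → ℝ)).measurableEmbedding.comp (MeasurableEquiv.measurableEmbedding _)
  rw [← integral_indicator measurableSet_ball, ← mp.integral_comp me, ← integral_comp_polarCoord_symm,
    mu_eq, ← setIntegral_congr_set (s := Set.Ioo 0 1 ×ˢ Set.Ioo (-π) π) (t := Set.Ioc 0 1 ×ˢ Set.Ioc (-π) π), polarCoord_target]
  · have hsub : Set.Ioo (0:ℝ) 1 ×ˢ Set.Ioo (-π) π ⊆ Set.Ioi (0:ℝ) ×ˢ Set.Ioo (-π) π :=
      Set.prod_mono Set.Ioo_subset_Ioi_self le_rfl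
    have hx : ∀ p : ℝ × ℝ, (WithLp.toLp 2 ((MeasurableEquiv.finTwoArrow (α := ℝ)).symm (polarCoord.symm p))) = XX p.1 p.2 := by
      intro p; ext i; fin_cases i <;> simp
    have hn : ∀ p : ℝ × ℝ, 0 < p.1 → ‖XX p.1 p.2‖ = p.1 := by
      intro p hp
      rw [EuclideanSpace.norm_eq, Fin.sum_univ_two]
      have : ‖XX p.1 p.2 0‖^2 + ‖XX p.1 p.2 1‖^2 = p.1^2 := by
        simp only [Real.norm_eq_abs, sq_abs]
        simp
        linear_combination p.1^2 * sin_sq_add_cos_sq p.2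
      rw [this, sqrt_sq hp.le]
    rw [setIntegral_eq_of_subset_of_forall_sdiff_eq_zero (measurableSet_Ioi.prod measurableSet_Ioo) hsub]
    · apply setIntegral_congr_fun (measurableSet_Ioo.prod measurableSet_Ioo)
      intro p hp
      simp only [Function.comp]
      rw [hx, Set.indicator_of_mem, h _ _ hp.1.1]; · rfl
      rw [mem_ball_zero_iff, hn p hp.1.1]; exact hp.1.2
    · intro p hp
      simp only [Function.comp]
      rw [hx, Set.indicator_of_notMem]; · simp
      rw [mem_ball_zero_iff, hn p hp.1.1]
      intro hlt
      exact hp.2 ⟨⟨hp.1.1, hlt⟩, hp.1.2⟩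
  · exact Measure.set_prod_ae_eq Ioo_ae_eq_Ioc Ioo_ae_eq_Ioc

def ze (h r : ℝ) : ℝ := (1 - r) / (r^2 + h^2)
def ka (h r : ℝ) : ℝ := ((1 - 2 * r) * (r^2+h^2) - 2 * r^2 * (1 - r)) / (r^2+h^2)^2

lemma ze_cont {h : ℝ} (hh : 0 < h) : Continuous (ze h) := by
  unfold ze
  exact Continuous.div (by fun_prop) (by fun_prop) (fun r => by positivity)
lemma ka_cont {h : ℝ} (hh : 0 < h) : Continuous (ka h) := by
  unfold ka
  exact Continuous.div (by fun_prop) (by fun_prop) (fun r => by positivity)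
lemma ze_deriv {h : ℝ} (hh : 0 < h) (r : ℝ) : HasDerivAt (fun r => r * ze h r) (ka h r) r := by
  have h1 : HasDerivAt (fun r : ℝ => r^2 + h^2) (2 * r) r := by
    simpa using (hasDerivAt_pow 2 r).add_const (h^2)
  have h2 : HasDerivAt (fun r : ℝ => 1 - r) (-1) r := by
    simpa using (hasDerivAt_id r).const_sub 1
  have hp : r^2 + h^2 ≠ 0 := by positivity
  have := (hasDerivAt_id r).mul (h2.div h1 hp)
  refine this.congr_deriv ?_
  simp only [ka, id, Pi.div_apply]
  field_simp
  ring

lemma comp_ineq {h : ℝ} (hh : 0 < h) (v0 v1 w00 w01 w11 : ℝ × ℝ → ℝ)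
    (cv0 : Continuous v0) (cv1 : Continuous v1) (c00 : Continuous w00) (c01 : Continuous w01)
    (c11 : Continuous w11)
    (p0 : ∀ r, v0 (r, -π) = v0 (r, π)) (p1 : ∀ r, v1 (r, -π) = v1 (r, π))
    (t0 : ∀ r t, HasDerivAt (fun t => v0 (r, t)) (r * (- sin t * w00 (r,t) + cos t * w01 (r,t))) t)
    (t1 : ∀ r t, HasDerivAt (fun t => v1 (r, t)) (r * (- sin t * w01 (r,t) + cos t * w11 (r,t))) t)
    (r0 : ∀ r t, HasDerivAt (fun r => v0 (r, t)) (cos t * w00 (r,t) + sin t * w01 (r,t)) r)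
    (r1 : ∀ r t, HasDerivAt (fun r => v1 (r, t)) (cos t * w01 (r,t) + sin t * w11 (r,t)) r) :
    ∫ p, p.1 * (ze h p.1 * (cos p.2 * v0 p + sin p.2 * v1 p)^2
        + ka h p.1 * (- sin p.2 * v0 p + cos p.2 * v1 p)^2) ∂mu
      ≤ ∫ p, p.1 * (w00 p^2 + w01 p^2 + w01 p^2 + w11 p^2) ∂mu := by
  have cz := ze_cont hh
  have ck := ka_cont hh
  let d0 : ℝ × ℝ → ℝ := fun p => p.1 * (- sin p.2 * w00 p + cos p.2 * w01 p)
  let d1 : ℝ × ℝ → ℝ := fun p => p.1 * (- sin p.2 * w01 p + cos p.2 * w11 p)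
  let a : ℝ × ℝ → ℝ := fun p => cos p.2 * v0 p + sin p.2 * v1 p
  let b : ℝ × ℝ → ℝ := fun p => - sin p.2 * v0 p + cos p.2 * v1 p
  let at' : ℝ × ℝ → ℝ := fun p => (- sin p.2 * v0 p + cos p.2 * d0 p) + (cos p.2 * v1 p + sin p.2 * d1 p)
  let bt' : ℝ × ℝ → ℝ := fun p => (- cos p.2 * v0 p + - sin p.2 * d0 p) + (- sin p.2 * v1 p + cos p.2 * d1 p)
  let br' : ℝ × ℝ → ℝ := fun p => - sin p.2 * (cos p.2 * w00 p + sin p.2 * w01 p)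
      + cos p.2 * (cos p.2 * w01 p + sin p.2 * w11 p)
  have cd0 : Continuous d0 := by fun_prop
  have cd1 : Continuous d1 := by fun_prop
  have ca : Continuous a := by fun_prop
  have cb : Continuous b := by fun_prop
  have cat : Continuous at' := by fun_prop
  have cbt : Continuous bt' := by fun_prop
  have cbr : Continuous br' := by fun_prop
  have hat : ∀ r t, HasDerivAt (fun t => a (r, t)) (at' (r, t)) t := fun r t =>
    ((hasDerivAt_cos t).mul (t0 r t)).add ((hasDerivAt_sin t).mul (t1 r t))
  have hbt : ∀ r t, HasDerivAt (fun t => b (r, t)) (bt' (r, t)) t := fun r t =>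
    ((hasDerivAt_sin t).neg.mul (t0 r t)).add ((hasDerivAt_cos t).mul (t1 r t))
  have hbr : ∀ r t, HasDerivAt (fun r => b (r, t)) (br' (r, t)) r := fun r t =>
    ((r0 r t).const_mul (- sin t)).add ((r1 r t).const_mul (cos t))
  -- the angular term
  have E1 : ∫ p, p.1 * ze h p.1 * (at' p * b p + a p * bt' p) ∂mu = 0 := by
    rw [mu_rt (by fun_prop)]
    have : ∀ r : ℝ, ∫ t in (-π)..π, r * ze h r * (at' (r,t) * b (r,t) + a (r,t) * bt' (r,t)) = 0 := by
      intro r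
      rw [intervalIntegral.integral_const_mul, intervalIntegral.integral_eq_sub_of_hasDerivAt
        (f := fun t => a (r,t) * b (r,t)) (fun t _ => (hat r t).mul (hbt r t))
        ((by fun_prop : Continuous _).intervalIntegrable _ _)]
      simp [a, b, p0, p1]
    simp [this]
  have E2 : ∫ p, ((ka h p.1) * (p.1 * b p ^ 2) + (p.1 * ze h p.1) * (b p ^ 2 + p.1 * (2 * b p * br' p))) ∂mu = 0 := by
    rw [mu_tr (by fun_prop)]
    have : ∀ t : ℝ, ∫ r in (0:ℝ)..1, ((ka h r) * (r * b (r,t) ^ 2) + (r * ze h r) * (b (r,t) ^ 2 + r * (2 * b (r,t) * br' (r,t)))) = 0 := by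
      intro t
      rw [intervalIntegral.integral_eq_sub_of_hasDerivAt
        (f := fun r => (r * ze h r) * (r * b (r,t) ^ 2)) (fun r _ => ?_)
        ((by fun_prop : Continuous _).intervalIntegrable _ _)]
      · simp [ze]
      · refine ((ze_deriv hh r).mul ((hasDerivAt_id r).mul ((hbr r t).pow 2))).congr_deriv ?_
        simp
    simp [this]
  have E3 : ∫ p, p.1 * (ze h p.1 * (cos p.2 * v0 p + sin p.2 * v1 p)^2
        + ka h p.1 * (- sin p.2 * v0 p + cos p.2 * v1 p)^2) ∂mu
      = ∫ p, p.1 * ze h p.1 * (v0 p * d1 p - v1 p * d0 p) ∂mu := by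
    rw [← sub_eq_zero, ← integral_sub (cint (by fun_prop)) (cint (by fun_prop)), ← E2, ← sub_eq_zero,
      ← integral_sub (cint (by fun_prop)) (cint (by fun_prop)), ← neg_eq_zero, ← integral_neg, ← E1]
    congr 1; ext p
    simp only [a, b, at', bt', br', d0, d1]
    have hs := sin_sq_add_cos_sq p.2
    have hs' : cos p.2 ^ 2 = 1 - sin p.2 ^ 2 := by linarith
    have hs3 : cos p.2 ^ 3 = cos p.2 * (1 - sin p.2 ^ 2) := by rw [← hs']; ring
    ring_nf
    simp only [hs', hs3]
    ring
  rw [E3]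
  have E4 : ∫ p, p.1 * ze h p.1 * (v0 p * d1 p - v1 p * d0 p) ∂mu
      ≤ ∫ p, p.1 * ze h p.1 * (d0 p ^ 2 + d1 p ^ 2) ∂mu := by
    have k0 : Continuous (fun p : ℝ × ℝ => p.1 * ze h p.1 * (v0 p * d1 p - v1 p * d0 p)) := by fun_prop
    have k1 : Continuous (fun p : ℝ × ℝ => p.1 * ze h p.1 * (d0 p ^ 2 + d1 p ^ 2)) := by fun_prop
    rw [mu_rt k0, mu_rt k1]
    apply intervalIntegral.integral_mono_on zero_le_one
    · exact (intervalIntegral.continuous_parametric_intervalIntegral_of_continuous' (f := fun r t => r * ze h r * (v0 (r,t) * d1 (r,t) - v1 (r,t) * d0 (r,t))) k0 _ _).intervalIntegrable _ _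
    · exact (intervalIntegral.continuous_parametric_intervalIntegral_of_continuous' (f := fun r t => r * ze h r * (d0 (r,t) ^ 2 + d1 (r,t) ^ 2)) k1 _ _).intervalIntegrable _ _
    · intro r hr
      simp only [intervalIntegral.integral_const_mul]
      have hz : 0 ≤ r * ze h r := mul_nonneg hr.1 (div_nonneg (by linarith [hr.2]) (by positivity))
      apply mul_le_mul_of_nonneg_left _ hz
      exact area_ineq (fun t => v0 (r,t)) (fun t => v1 (r,t)) (fun t => d0 (r,t)) (fun t => d1 (r,t))
        (t0 r) (t1 r) (by fun_prop) (by fun_prop) (p0 r) (p1 r)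
  refine E4.trans (integral_mono_ae (cint (by fun_prop)) (cint (by fun_prop)) (mu_ae ?_))
  intro r t hr hr1
  simp only [d0, d1]
  generalize w00 (r,t) = x
  generalize w01 (r,t) = y
  generalize w11 (r,t) = z
  have hz0 : 0 ≤ r^2 * ze h r := mul_nonneg (by positivity) (div_nonneg (by linarith) (by positivity))
  have hz : r^2 * ze h r ≤ 1 := by
    unfold ze
    rw [← mul_div_assoc, div_le_one (by positivity)]
    nlinarith [sq_nonneg h, pow_pos hr 3]
  have hs := sin_sq_add_cos_sq t
  have hq : (- sin t * x + cos t * y)^2 + (- sin t * y + cos t * z)^2 ≤ x^2+y^2+y^2+z^2 := by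
    have : x^2+y^2+y^2+z^2 - ((- sin t * x + cos t * y)^2 + (- sin t * y + cos t * z)^2)
      = (cos t * x + sin t * y)^2 + (cos t * y + sin t * z)^2 := by
      linear_combination -(x^2+y^2+y^2+z^2) * hs
    nlinarith [sq_nonneg (cos t * x + sin t * y), sq_nonneg (cos t * y + sin t * z)]
  calc r * ze h r * ((r * (- sin t * x + cos t * y))^2 + (r * (- sin t * y + cos t * z))^2)
      = r * ((r^2 * ze h r) * ((- sin t * x + cos t * y)^2 + (- sin t * y + cos t * z)^2)) := by ring
    _ ≤ r * (1 * (x^2+y^2+y^2+z^2)) := by gcongr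
    _ = _ := by ring

lemma XX_eq (r t : ℝ) : XX r t = (r * cos t) • e2 0 + (r * sin t) • e2 1 := by
  ext i; fin_cases i <;> simp [e2]

lemma XX_cont : Continuous (fun p : ℝ × ℝ => XX p.1 p.2) := by
  simp only [XX_eq]; fun_prop

lemma pd_contDiff {n : WithTop ℕ∞} {u : E2 → ℝ} (hu : ContDiff ℝ (n+1) u) (j : Fin 2) : ContDiff ℝ n (pd j u) := by
  unfold pd
  exact (hu.fderiv_right le_rfl).clm_apply contDiff_const

lemma pd_t {f : E2 → ℝ} (hf : Differentiable ℝ f) (r t : ℝ) :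
    HasDerivAt (fun t => f (XX r t)) (r * (- sin t * pd 0 f (XX r t) + cos t * pd 1 f (XX r t))) t := by
  have h1 : HasDerivAt (fun t => XX r t) ((r * - sin t) • e2 0 + (r * cos t) • e2 1) t := by
    simp only [XX_eq]
    exact (((hasDerivAt_cos t).const_mul r).smul_const _).add (((hasDerivAt_sin t).const_mul r).smul_const _)
  refine ((hf (XX r t)).hasFDerivAt.comp_hasDerivAt t h1).congr_deriv ?_
  simp only [map_add, map_smul, pd, smul_eq_mul]; ring

lemma pd_r {f : E2 → ℝ} (hf : Differentiable ℝ f) (r t : ℝ) :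
    HasDerivAt (fun r => f (XX r t)) (cos t * pd 0 f (XX r t) + sin t * pd 1 f (XX r t)) r := by
  have h1 : HasDerivAt (fun r => XX r t) ((1 * cos t) • e2 0 + (1 * sin t) • e2 1) r := by
    simp only [XX_eq]
    exact (((hasDerivAt_id r).mul_const _).smul_const _).add (((hasDerivAt_id r).mul_const _).smul_const _)
  refine ((hf (XX r t)).hasFDerivAt.comp_hasDerivAt r h1).congr_deriv ?_
  simp only [map_add, map_smul, pd, smul_eq_mul]; ring

lemma pd_symm {u : E2 → ℝ} (hu : ContDiff ℝ 2 u) (x : E2) : pd 1 (pd 0 u) x = pd 0 (pd 1 u) x := by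
  have hd : Differentiable ℝ (fderiv ℝ u) := (hu.fderiv_right (m := 1) (by norm_num)).differentiable (by norm_num)
  have key : ∀ i j : Fin 2, pd i (pd j u) x = fderiv ℝ (fderiv ℝ u) x (e2 i) (e2 j) := by
    intro i j
    unfold pd
    rw [fderiv_clm_apply (hd x) (differentiableAt_const _)]
    simp
  rw [key, key]
  exact (hu.contDiffAt.isSymmSndFDerivAt (by simp)).eq _ _

lemma comp_u {h : ℝ} (hh : 0 < h) {u : E2 → ℝ} (hu : ContDiff ℝ 2 u) :
    ∫ p, p.1 * (ze h p.1 * (cos p.2 * pd 0 u (XX p.1 p.2) + sin p.2 * pd 1 u (XX p.1 p.2))^2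
        + ka h p.1 * (- sin p.2 * pd 0 u (XX p.1 p.2) + cos p.2 * pd 1 u (XX p.1 p.2))^2) ∂mu
      ≤ ∫ p, p.1 * frob2 (hess u (XX p.1 p.2)) ∂mu := by
  have c1 : ∀ j, ContDiff ℝ 1 (pd j u) := fun j => pd_contDiff (n := 1) (by norm_num; exact hu) j
  have c2 : ∀ i j, Continuous (pd i (pd j u)) := fun i j =>
    (pd_contDiff (n := 0) (by norm_num; exact c1 j) i).continuous
  have d1 : ∀ j, Differentiable ℝ (pd j u) := fun j => (c1 j).differentiable (by norm_num)
  have XP : ∀ r, XX r (-π) = XX r π := by intro r; simp [XX]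
  have := comp_ineq hh (fun p => pd 0 u (XX p.1 p.2)) (fun p => pd 1 u (XX p.1 p.2))
    (fun p => pd 0 (pd 0 u) (XX p.1 p.2)) (fun p => pd 0 (pd 1 u) (XX p.1 p.2))
    (fun p => pd 1 (pd 1 u) (XX p.1 p.2))
    ((c1 0).continuous.comp XX_cont) ((c1 1).continuous.comp XX_cont)
    ((c2 0 0).comp XX_cont) ((c2 0 1).comp XX_cont) ((c2 1 1).comp XX_cont)
    (fun r => by simp only [XP]) (fun r => by simp only [XP])
    (fun r t => by
      have := pd_t (d1 0) r t
      rwa [pd_symm hu] at this)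
    (fun r t => pd_t (d1 1) r t)
    (fun r t => by
      have := pd_r (d1 0) r t
      rwa [pd_symm hu] at this)
    (fun r t => pd_r (d1 1) r t)
  refine this.trans (le_of_eq ?_)
  congr 1; ext p
  simp only [frob2, hess, Fin.sum_univ_two, Matrix.of_apply, pd_symm hu]
  ring

lemma mu_rad {f : ℝ → ℝ} (hf : Continuous f) : ∫ p, f p.1 ∂mu = 2 * π * ∫ r in (0:ℝ)..1, f r := by
  rw [mu_rt (F := fun p => f p.1) (by fun_prop)]
  simp only [intervalIntegral.integral_const, smul_eq_mul]
  rw [intervalIntegral.integral_const_mul]; ring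

lemma rad1 {h : ℝ} (hh : 0 < h) : Real.log (1 / h) - 1 ≤ ∫ r in (0:ℝ)..1, r * ze h r := by
  have hc : Continuous (fun r : ℝ => r / (r^2 + h^2)) :=
    Continuous.div (by fun_prop) (by fun_prop) (fun r => by positivity)
  have e : ∫ r in (0:ℝ)..1, (r / (r^2+h^2) - 1) = (Real.log (1 + h^2) / 2 - 1) - (Real.log (h^2) / 2) := by
    rw [intervalIntegral.integral_eq_sub_of_hasDerivAt
      (f := fun r => Real.log (r^2 + h^2) / 2 - r) (fun r _ => ?_)
      ((by fun_prop : Continuous _).intervalIntegrable _ _)]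
    · simp
    · have h1 : HasDerivAt (fun r : ℝ => r^2 + h^2) (2 * r) r := by
        simpa using (hasDerivAt_pow 2 r).add_const (h^2)
      refine (((h1.log (by positivity)).div_const 2).sub (hasDerivAt_id r)).congr_deriv ?_
      field_simp
  have : Real.log (1 / h) - 1 ≤ ∫ r in (0:ℝ)..1, (r / (r^2+h^2) - 1) := by
    rw [e, Real.log_pow, one_div, Real.log_inv]
    have := Real.log_nonneg (by nlinarith : (1:ℝ) ≤ 1 + h^2)
    push_cast; linarith
  refine this.trans (intervalIntegral.integral_mono_on zero_le_one ((by fun_prop : Continuous _).intervalIntegrable _ _)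
    ((continuous_id.mul (ze_cont hh)).intervalIntegrable _ _) ?_)
  intro r hr
  simp only [ze]
  have hp : 0 < r^2 + h^2 := by positivity
  rw [div_sub_one hp.ne', ← mul_div_assoc]
  gcongr
  nlinarith

lemma rad2 {h : ℝ} (hh : 0 < h) : ∫ r in (0:ℝ)..1, r * ka h r = - ∫ r in (0:ℝ)..1, r * ze h r := by
  have cz := ze_cont hh
  have ck := ka_cont hh
  rw [eq_neg_iff_add_eq_zero, ← intervalIntegral.integral_add ((by fun_prop : Continuous _).intervalIntegrable _ _)
    ((by fun_prop : Continuous _).intervalIntegrable _ _), intervalIntegral.integral_eq_sub_of_hasDerivAt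
      (f := fun r => r * (r * ze h r)) (fun r _ => ?_)
      ((by fun_prop : Continuous _).intervalIntegrable _ _)]
  · simp [ze]
  · refine ((hasDerivAt_id r).mul (ze_deriv hh r)).congr_deriv ?_
    simp; ring

lemma rad3 {h : ℝ} (hh : 0 < h) : ∫ r in (0:ℝ)..1, r * (5 * h^2 / (r^2+h^2)^2) ≤ 5 / 2 := by
  have hc : Continuous (fun r : ℝ => 5 * h^2 / (r^2 + h^2)^2) :=
    Continuous.div (by fun_prop) (by fun_prop) (fun r => by positivity)
  rw [intervalIntegral.integral_eq_sub_of_hasDerivAt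
      (f := fun r => (-5 / 2 * h^2) * (r^2 + h^2)⁻¹) (fun r _ => ?_)
      ((by fun_prop : Continuous _).intervalIntegrable _ _)]
  · have : 0 < h^2 * (1^2+h^2)⁻¹ := by positivity
    have : h^2 * (0^2+h^2)⁻¹ = 1 := by field_simp; ring
    linarith
  · have h1 : HasDerivAt (fun r : ℝ => r^2 + h^2) (2 * r) r := by
      simpa using (hasDerivAt_pow 2 r).add_const (h^2)
    refine ((h1.inv (by positivity)).const_mul _).congr_deriv ?_
    field_simp

lemma ptwise {h r ζ κ x y G : ℝ} (hh : 0 < h) (hr : 0 < r) (hr1 : r ≤ 1) (hz : ζ = ze h r) (hk : κ = ka h r)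
    (hG : x^2 + y^2 ≤ G) :
    - (r * G) / (2 * h^2) - r * (5 * h^2 / (r^2+h^2)^2) ≤ r * (ζ * x + κ * y) := by
  have hp : 0 < r^2 + h^2 := by positivity
  have hz' : ζ^2 ≤ 1 / (r^2+h^2)^2 := by
    rw [hz, ze, div_pow]; gcongr; nlinarith
  have hk' : κ^2 ≤ 9 / (r^2+h^2)^2 := by
    have : κ = ((1 - 2 * r) - 2 * (1 - r) * (r^2 / (r^2+h^2))) / (r^2+h^2) := by
      rw [hk, ka]; field_simp
    rw [this, div_pow]; gcongr
    have q0 : 0 ≤ r^2 / (r^2+h^2) := by positivity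
    have q1 : r^2 / (r^2+h^2) ≤ 1 := by rw [div_le_one hp]; nlinarith
    rw [show (9:ℝ) = 3^2 by norm_num]
    apply sq_le_sq'
    · nlinarith
    · nlinarith
  have A : - (x^2 / (2*h^2) + h^2/2 * ζ^2) ≤ ζ * x := by
    have : x^2 / (2*h^2) + h^2/2 * ζ^2 + ζ * x = (x / h + h * ζ)^2 / 2 := by field_simp; ring
    nlinarith [sq_nonneg (x / h + h * ζ)]
  have B : - (y^2 / (2*h^2) + h^2/2 * κ^2) ≤ κ * y := by
    have : y^2 / (2*h^2) + h^2/2 * κ^2 + κ * y = (y / h + h * κ)^2 / 2 := by field_simp; ring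
    nlinarith [sq_nonneg (y / h + h * κ)]
  have C : x^2 / (2*h^2) + y^2 / (2*h^2) ≤ G / (2*h^2) := by
    rw [← add_div]; gcongr
  have D : h^2/2 * ζ^2 + h^2/2 * κ^2 ≤ 5 * h^2 / (r^2+h^2)^2 := by
    calc _ ≤ h^2/2 * (1 / (r^2+h^2)^2) + h^2/2 * (9 / (r^2+h^2)^2) := by gcongr
      _ = _ := by ring
  calc _ = r * (- (G / (2*h^2)) - 5 * h^2 / (r^2+h^2)^2) := by ring
    _ ≤ _ := by
      apply mul_le_mul_of_nonneg_left _ hr.le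
      linarith

lemma rot_sq (c s A B D : ℝ) (hs : s^2 + c^2 = 1) :
    (c^2*A + 2*c*s*B + s^2*D)^2 + (s^2*A - 2*c*s*B + c^2*D)^2 ≤ A^2 + B^2 + (B^2 + D^2) := by
  have : A^2 + B^2 + (B^2 + D^2) - ((c^2*A + 2*c*s*B + s^2*D)^2 + (s^2*A - 2*c*s*B + c^2*D)^2)
     = 2 * (-c*s*A + (c^2-s^2)*B + c*s*D)^2 := by
    linear_combination -(A^2 + B^2 + (B^2 + D^2)) * (s^2+c^2+1) * hs
  nlinarith [sq_nonneg (-c*s*A + (c^2-s^2)*B + c*s*D)]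

/-- membrane-energy bound for almost-minimizers. -/
theorem stmt_3 (Δ : ℝ) (hΔ0 : 0 < Δ) (hΔ1 : Δ < 1) (C₂ : ℝ) (hC₂ : 0 < C₂) :
    ∃ C₃ > (0 : ℝ), ∃ h₀ ∈ Set.Ioo (0 : ℝ) 1, ∀ h ∈ Set.Ioo (0 : ℝ) h₀,
      ∀ y : E2 → E3, ContDiff ℝ 2 y →
        energy h Δ y ≤ 2 * π * Δ ^ 2 * h ^ 2 * (Real.log (1 / h) + C₂) →
        ∫ x in ball (0 : E2) 1, frob2 (gmet y x - gDelta Δ x) ≤ C₃ * h ^ 2 := by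
  refine ⟨4 * π * Δ ^ 2 * (C₂ + 1) + 10 * π, by positivity, 1 / 2, by norm_num, ?_⟩
  rintro h ⟨hh, -⟩ y hy hE
  have hu : ∀ i, ContDiff ℝ 2 (fun z => y z i) := fun i => contDiff_euclidean.1 hy i
  have c1 : ∀ i j, ContDiff ℝ 1 (pd j (fun z => y z i)) := fun i j =>
    pd_contDiff (n := 1) (by norm_num; exact hu i) j
  have c2 : ∀ i k j, Continuous (pd k (pd j (fun z => y z i))) := fun i k j =>
    (pd_contDiff (n := 0) (by norm_num; exact c1 i j) k).continuous
  have cz := ze_cont hh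
  have ck := ka_cont hh
  let V : Fin 3 → Fin 2 → ℝ × ℝ → ℝ := fun i j p => pd j (fun z => y z i) (XX p.1 p.2)
  have cV : ∀ i j, Continuous (V i j) := fun i j => (c1 i j).continuous.comp XX_cont
  let g : Fin 2 → Fin 2 → ℝ × ℝ → ℝ := fun k l p => ∑ i, V i k p * V i l p
  have cg : ∀ k l, Continuous (g k l) := fun k l => by fun_prop
  let A : ℝ × ℝ → ℝ := fun p => g 0 0 p - (1 - Δ^2 * sin p.2 ^ 2)
  let B : ℝ × ℝ → ℝ := fun p => g 0 1 p - (Δ^2 * sin p.2 * cos p.2)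
  let D : ℝ × ℝ → ℝ := fun p => g 1 1 p - (1 - Δ^2 * cos p.2 ^ 2)
  have cA : Continuous A := by fun_prop
  have cB : Continuous B := by fun_prop
  have cD : Continuous D := by fun_prop
  let G : ℝ × ℝ → ℝ := fun p => A p ^ 2 + B p ^ 2 + (B p ^ 2 + D p ^ 2)
  have cG : Continuous G := by fun_prop
  let Hi : Fin 3 → ℝ × ℝ → ℝ := fun i p => frob2 (hess (fun z => y z i) (XX p.1 p.2))
  have cHi : ∀ i, Continuous (Hi i) := by
    intro i
    have : ∀ k j, Continuous fun p : ℝ × ℝ => pd k (pd j (fun z => y z i)) (XX p.1 p.2) :=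
      fun k j => (c2 i k j).comp XX_cont
    simp only [Hi, frob2, hess, Matrix.of_apply]
    fun_prop
  let H : ℝ × ℝ → ℝ := fun p => ∑ i, Hi i p
  have cH : Continuous H := by fun_prop
  have hG : ∀ r t, 0 < r → frob2 (gmet y (XX r t) - gDelta Δ (XX r t)) = G (r, t) := by
    intro r t hr
    have hn : ‖XX r t‖ ^ 2 = r ^ 2 := by
      rw [EuclideanSpace.norm_sq_eq, Fin.sum_univ_two]
      simp only [Real.norm_eq_abs, sq_abs]
      simp
      linear_combination r^2 * sin_sq_add_cos_sq t
    have hr' : r ≠ 0 := hr.ne'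
    have hDel : ∀ k l, gDelta Δ (XX r t) k l = (1 : Matrix (Fin 2) (Fin 2) ℝ) k l
        - Δ^2 * (![- sin t, cos t] k) * (![- sin t, cos t] l) := by
      intro k l
      simp only [gDelta, hn, Matrix.sub_apply, Matrix.of_apply, perpVec]
      fin_cases k <;> fin_cases l <;> simp <;> field_simp
    have hg : ∀ k l, gmet y (XX r t) k l = g k l (r, t) := by
      intro k l
      simp [gmet, Matrix.mul_apply, Dmat, g, V]
    have hsym : g 1 0 (r,t) = g 0 1 (r,t) := by simp only [g, mul_comm]
    simp only [frob2, Fin.sum_univ_two, Matrix.sub_apply, hg, hDel, hsym, G, A, B, D]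
    simp
    ring
  have PM := polar (fun x => frob2 (gmet y x - gDelta Δ x)) G hG
  have PE := polar (fun x => frob2 (gmet y x - gDelta Δ x) + h ^ 2 * hessNormSq y x)
    (fun p => G p + h ^ 2 * H p) (fun r t hr => by simp only [hG r t hr]; rfl)
  rw [energy, PE] at hE
  rw [PM]
  set M := ∫ p, p.1 * G p ∂mu with hM
  have hE' : ∫ p, p.1 * (G p + h ^ 2 * H p) ∂mu = M + h ^ 2 * ∫ p, p.1 * H p ∂mu := by
    rw [hM, ← integral_const_mul, ← integral_add (cint (by fun_prop)) (cint (by fun_prop))]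
    congr 1; ext p; ring
  rw [hE'] at hE
  let al : ℝ × ℝ → ℝ := fun p => cos p.2 ^ 2 * A p + 2 * cos p.2 * sin p.2 * B p + sin p.2 ^ 2 * D p
  let be : ℝ × ℝ → ℝ := fun p => sin p.2 ^ 2 * A p - 2 * cos p.2 * sin p.2 * B p + cos p.2 ^ 2 * D p
  have cal : Continuous al := by fun_prop
  have cbe : Continuous be := by fun_prop
  have S1 : ∫ p, p.1 * (ze h p.1 * (1 + al p) + ka h p.1 * ((1 - Δ^2) + be p)) ∂mu ≤ ∫ p, p.1 * H p ∂mu := by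
    have e1 : ∫ p, p.1 * H p ∂mu = ∑ i, ∫ p, p.1 * Hi i p ∂mu := by
      rw [← integral_finset_sum _ (fun i _ => cint (by fun_prop))]
      congr 1; ext p; simp only [H, Finset.mul_sum]
    have e2 : ∫ p, p.1 * (ze h p.1 * (1 + al p) + ka h p.1 * ((1 - Δ^2) + be p)) ∂mu =
        ∑ i, ∫ p, p.1 * (ze h p.1 * (cos p.2 * V i 0 p + sin p.2 * V i 1 p)^2
        + ka h p.1 * (- sin p.2 * V i 0 p + cos p.2 * V i 1 p)^2) ∂mu := by
      rw [← integral_finset_sum _ (fun i _ => cint (by fun_prop))]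
      congr 1; ext p
      have hs := sin_sq_add_cos_sq p.2
      have ea : 1 + al p = ∑ i, (cos p.2 * V i 0 p + sin p.2 * V i 1 p)^2 := by
        simp only [al, A, B, D, g, Fin.sum_univ_three]
        linear_combination (-1) * hs
      have eb : (1 - Δ^2) + be p = ∑ i, (- sin p.2 * V i 0 p + cos p.2 * V i 1 p)^2 := by
        simp only [be, A, B, D, g, Fin.sum_univ_three]
        linear_combination (Δ^2 * (sin p.2 ^2 + cos p.2 ^2 + 1) - 1) * hs
      rw [ea, eb]
      simp only [Fin.sum_univ_three]; ring
    rw [e1, e2]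
    exact Finset.sum_le_sum fun i _ => comp_u hh (hu i)
  have c5 : Continuous (fun r : ℝ => 5 * h^2 / (r^2 + h^2)^2) :=
    Continuous.div (by fun_prop) (by fun_prop) (fun r => by positivity)
  have c5' : Continuous (fun p : ℝ × ℝ => 5 * h^2 / (p.1^2 + h^2)^2) := c5.comp continuous_fst
  have S2 : ∫ p, (p.1 * ze h p.1 + (1 - Δ^2) * (p.1 * ka h p.1)
      + (- (p.1 * G p) / (2 * h^2) - p.1 * (5 * h^2 / (p.1^2+h^2)^2))) ∂mu
      ≤ ∫ p, p.1 * (ze h p.1 * (1 + al p) + ka h p.1 * ((1 - Δ^2) + be p)) ∂mu := by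
    refine integral_mono_ae (cint (by fun_prop)) (cint (by fun_prop)) (mu_ae ?_)
    intro r t hr hr1
    have := ptwise (x := al (r,t)) (y := be (r,t)) (G := G (r,t)) hh hr hr1 rfl rfl
      (rot_sq _ _ _ _ _ (sin_sq_add_cos_sq t))
    simp only
    linarith
  have S3 : ∫ p, (p.1 * ze h p.1 + (1 - Δ^2) * (p.1 * ka h p.1)
      + (- (p.1 * G p) / (2 * h^2) - p.1 * (5 * h^2 / (p.1^2+h^2)^2))) ∂mu
      = 2 * π * (∫ r in (0:ℝ)..1, r * ze h r) + (1 - Δ^2) * (2 * π * (∫ r in (0:ℝ)..1, r * ka h r))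
        + (- M / (2 * h^2) - 2 * π * (∫ r in (0:ℝ)..1, r * (5 * h^2 / (r^2+h^2)^2))) := by
    rw [integral_add (cint (by fun_prop)) (cint (by fun_prop)), integral_add (cint (by fun_prop)) (cint (by fun_prop)),
      integral_sub (cint (by fun_prop)) (cint (by fun_prop)), integral_const_mul, integral_div, integral_neg,
      mu_rad (f := fun r => r * ze h r) (by fun_prop), mu_rad (f := fun r => r * ka h r) (by fun_prop),
      mu_rad (f := fun r => r * (5 * h^2 / (r^2+h^2)^2)) (by fun_prop)]
  rw [S3, rad2 hh] at S2
  have R1 := rad1 hh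
  have R3 := rad3 hh
  have hpi := pi_pos
  have T := S2.trans S1
  have T1 : 2 * π * Δ^2 * (Real.log (1 / h) - 1) - 5 * π - M / (2 * h^2) ≤ ∫ p, p.1 * H p ∂mu := by
    refine le_trans ?_ T
    have a1 := mul_le_mul_of_nonneg_left R1 (by positivity : 0 ≤ 2 * π * Δ^2)
    have a2 := mul_le_mul_of_nonneg_left R3 (by positivity : 0 ≤ 2 * π)
    have a3 : - M / (2 * h^2) = - (M / (2*h^2)) := by ring
    rw [a3]
    linarith
  have T2 := mul_le_mul_of_nonneg_left T1 (by positivity : 0 ≤ h^2)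
  have T3 : h^2 * (M / (2*h^2)) = M / 2 := by field_simp
  nlinarith
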